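/- arXiv:1510.08386 — 3 statements merged into one kernel-verified Lean document; each statement's English description precedes it below -/
import Mathlib

section
/- Let R be a regular local ring of Krull dimension 2 and let M be a finitely generated torsion R-module (every element of M is annihilated by some nonzero element of R) whose only submodule of finite length is the zero submodule. Then there exist n ∈ ℕ and an injective R-linear map φ : R^n → R^n with R^n / φ(R^n) ≅ M. -/
open IsLocalRing

/-- A prime properly contained in a principal ideal `(z)` vanishes when `z` is in the Jacobson
radical. -/
theorem Ideal.IsPrime.eq_bot_of_lt_span_singleton {R : Type*} [CommRing R] [IsNoetherianRing R]
    {p : Ideal R} (hp : p.IsPrime) {z : R} (hz : z ∈ (⊥ : Ideal R).jacobson)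
    (hlt : p < Ideal.span {z}) : p = ⊥ := by
  have hzp : z ∉ p := fun h ↦ hlt.not_ge ((Ideal.span_singleton_le_iff_mem _).2 h)
  refine Submodule.eq_bot_of_le_smul_of_le_jacobson_bot (Ideal.span {z}) p
    (IsNoetherian.noetherian p) (fun a ha ↦ ?_) ((Ideal.span_singleton_le_iff_mem _).2 hz)
  obtain ⟨b, rfl⟩ := Ideal.mem_span_singleton'.1 (hlt.le ha)
  rw [mul_comm]
  exact Submodule.smul_mem_smul (Ideal.mem_span_singleton_self z)
    ((hp.mem_or_mem ha).resolve_right hzp)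

/-- In a local ring whose maximal ideal is `(x, y)`, any element of the maximal ideal outside its
square is part of a two-element generating set. -/
theorem IsLocalRing.exists_maximalIdeal_eq_span_pair_of_notMem_sq {R : Type*} [CommRing R]
    [IsLocalRing R] {x y : R} (hxy : maximalIdeal R = Ideal.span {x, y}) {z : R}
    (hz : z ∈ maximalIdeal R) (hz2 : z ∉ maximalIdeal R ^ 2) :
    ∃ w, maximalIdeal R = Ideal.span {z, w} := by
  have hx : x ∈ maximalIdeal R := hxy ▸ Ideal.subset_span (by simp)
  have hy : y ∈ maximalIdeal R := hxy ▸ Ideal.subset_span (by simp)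
  obtain ⟨a, b, rfl⟩ := Ideal.mem_span_pair.1 (hxy ▸ hz)
  have key : IsUnit a ∨ IsUnit b := by
    by_contra! h
    refine hz2 ?_
    rw [pow_two]
    exact add_mem (Ideal.mul_mem_mul h.1 hx) (Ideal.mul_mem_mul h.2 hy)
  rcases key with h | h
  · obtain ⟨c, hc⟩ := h.exists_left_inv
    refine ⟨y, le_antisymm ?_ ?_⟩
    · rw [hxy, Ideal.span_le]
      rintro t (rfl | rfl)
      · exact Ideal.mem_span_pair.2 ⟨c, -(c * b), by linear_combination t * hc⟩
      · exact Ideal.subset_span (by simp)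
    · rw [Ideal.span_le]
      rintro t (rfl | rfl)
      exacts [hz, hy]
  · obtain ⟨c, hc⟩ := h.exists_left_inv
    refine ⟨x, le_antisymm ?_ ?_⟩
    · rw [hxy, Ideal.span_le]
      rintro t (rfl | rfl)
      · exact Ideal.subset_span (by simp)
      · exact Ideal.mem_span_pair.2 ⟨c, -(c * a), by linear_combination t * hc⟩
    · rw [Ideal.span_le]
      rintro t (rfl | rfl)
      exacts [hz, hx]

/-- If `(z, w)` is the maximal ideal and it is not minimal over `(z)`, then `(z)` is prime. -/
theorem IsLocalRing.isPrime_span_singleton_of_maximalIdeal_eq_span_pair {R : Type*} [CommRing R]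
    [IsLocalRing R] [IsNoetherianRing R] {z w : R} (h : maximalIdeal R = Ideal.span {z, w})
    (hmin : maximalIdeal R ∉ (Ideal.span {z}).minimalPrimes) : (Ideal.span {z}).IsPrime := by
  have hz : z ∈ maximalIdeal R := h ▸ Ideal.subset_span (by simp)
  have hw : w ∈ maximalIdeal R := h ▸ Ideal.subset_span (by simp)
  have hzm : Ideal.span {z} ≤ maximalIdeal R := (Ideal.span_singleton_le_iff_mem _).2 hz
  obtain ⟨q, hq, hqm⟩ := Ideal.exists_minimalPrimes_le hzm
  have hqp : q.IsPrime := hq.1.1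
  have hzq : z ∈ q := hq.1.2 (Ideal.mem_span_singleton_self z)
  have hwq : w ∉ q := fun hwq ↦ by
    suffices heq : maximalIdeal R = q from hmin (heq ▸ hq)
    refine le_antisymm ?_ hqm
    rw [h, Ideal.span_le]
    rintro t (rfl | rfl)
    exacts [hzq, hwq]
  have hqz : q ≤ Ideal.span {z} := by
    refine Submodule.le_of_le_smul_of_le_jacobson_bot (IsNoetherian.noetherian q)
      (maximalIdeal_le_jacobson _) fun a ha ↦ ?_
    obtain ⟨b, c, rfl⟩ := Ideal.mem_span_pair.1 (h ▸ hqm ha)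
    have hcw : c * w ∈ q := (q.add_mem_iff_right (q.mul_mem_left b hzq)).1 ha
    refine Submodule.add_mem_sup (Ideal.mem_span_singleton'.2 ⟨b, rfl⟩) ?_
    rw [mul_comm c w]
    exact Submodule.smul_mem_smul hw ((hqp.mem_or_mem hcw).resolve_right hwq)
  rwa [← le_antisymm hqz hq.1.2]

/-- The maximal ideal is not associated to a module without nonzero finite length submodules. -/
theorem IsLocalRing.maximalIdeal_notMem_associatedPrimes {R : Type*} [CommRing R] [IsLocalRing R]
    [IsNoetherianRing R] {M : Type*} [AddCommGroup M] [Module R M]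
    (hM : ∀ N : Submodule R M, IsFiniteLength R N → N = ⊥) :
    maximalIdeal R ∉ associatedPrimes R M := by
  intro h
  obtain ⟨-, m, hm⟩ := isAssociatedPrime_iff.1 h
  have hker : LinearMap.ker (LinearMap.toSpanSingleton R M m) = maximalIdeal R := by
    ext r
    rw [hm, Submodule.mem_colon_singleton]
    simp
  have hs : IsSimpleModule R (R ⧸ maximalIdeal R) :=
    isSimpleModule_iff_isCoatom.2 (maximalIdeal.isMaximal R).out
  have e := (Submodule.quotEquivOfEq _ _ hker).symm ≪≫ₗ
    (LinearMap.toSpanSingleton R M m).quotKerEquivRange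
  have hbot := hM _ (e.isFiniteLength (isFiniteLength_iff_isNoetherian_isArtinian.2
    ⟨inferInstance, inferInstance⟩))
  rw [LinearMap.range_eq_bot] at hbot
  rw [hbot, LinearMap.ker_zero] at hker
  exact (maximalIdeal.isMaximal R).ne_top hker.symm

open scoped Pointwise in
/-- Let `z` be a nonzero prime element in the Jacobson radical such that `R ⧸ (z)` is a principal
ideal domain. A submodule `K` of `Rⁿ` such that `z` is regular on `Rⁿ ⧸ K` is free. -/
theorem Submodule.free_of_forall_mem_of_smul_mem {R : Type*} [CommRing R] [IsDomain R]
    [IsNoetherianRing R] {z : R} (hz : z ∈ (⊥ : Ideal R).jacobson) (hz0 : z ≠ 0)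
    [hzp : (Ideal.span {z}).IsPrime] [IsPrincipalIdealRing (R ⧸ Ideal.span {z})] {ι : Type*}
    [Finite ι] (K : Submodule R (ι → R)) (hK : ∀ v, z • v ∈ K → v ∈ K) : Module.Free R K := by
  have hcancel (r : R) (k : K) (hr : r ∉ Ideal.span {z})
      (hrk : r • k ∈ z • (⊤ : Submodule R K)) : k ∈ z • (⊤ : Submodule R K) := by
    obtain ⟨k', -, hk'⟩ := (Submodule.mem_smul_pointwise_iff_exists _ _ _).1 hrk
    have hdvd (i : ι) : ∃ v, z * v = k.1 i := by
      have h1 : r * k.1 i ∈ Ideal.span {z} := Ideal.mem_span_singleton.2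
        ⟨k'.1 i, (congrFun (congrArg Subtype.val hk') i).symm⟩
      obtain ⟨v, hv⟩ := Ideal.mem_span_singleton.1 ((hzp.mem_or_mem h1).resolve_left hr)
      exact ⟨v, hv.symm⟩
    choose v hv using hdvd
    have hvk : z • v = k.1 := funext hv
    exact (Submodule.mem_smul_pointwise_iff_exists _ _ _).2
      ⟨⟨v, hK v (hvk ▸ k.2)⟩, trivial, Subtype.ext hvk⟩
  have : Module.FinitePresentation R K := Module.finitePresentation_of_finite R K
  rw [← Module.free_quotSMulTop_iff_free R K hz (IsRegular.of_ne_zero hz0).isSMulRegular]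
  have : Module.Finite (R ⧸ Ideal.span {z}) (QuotSMulTop z K) :=
    Module.Finite.of_restrictScalars_finite R _ _
  have : Module.IsTorsionFree (R ⧸ Ideal.span {z}) (QuotSMulTop z K) := by
    refine .of_smul_eq_zero fun r k ↦ ?_
    induction r using Quotient.inductionOn' with | _ r
    induction k using Quotient.inductionOn' with | _ k
    intro hrk
    rw [or_iff_not_imp_left]
    intro hr
    exact (Submodule.Quotient.mk_eq_zero _).2 (hcancel r k
      (fun h ↦ hr (Ideal.Quotient.eq_zero_iff_mem.2 h)) ((Submodule.Quotient.mk_eq_zero _).1 hrk))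
  infer_instance


/-- Let `R` be a regular local ring of Krull dimension `2` (a Noetherian local ring of Krull
dimension `2` whose maximal ideal is generated by two elements) and let `M` be a finitely
generated torsion `R`-module whose only finite-length submodule is `⊥`.  Then there exist
`n ∈ ℕ` and an injective `R`-linear map `φ : R^n → R^n` with `R^n / φ(R^n) ≅ M`. -/
theorem exists_square_presentation_of_torsion_no_finite_length_submodule
    (R : Type) [CommRing R] [IsLocalRing R] [IsNoetherianRing R]
    (hdim : ringKrullDim R = 2)
    (hreg : ∃ x y : R, IsLocalRing.maximalIdeal R = Ideal.span {x, y})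
    (M : Type) [AddCommGroup M] [Module R M] [Module.Finite R M]
    (htor : ∀ m : M, ∃ r : R, r ≠ 0 ∧ r • m = 0)
    (hM : ∀ N : Submodule R M, IsFiniteLength R N → N = ⊥) :
    ∃ (n : ℕ) (φ : (Fin n → R) →ₗ[R] (Fin n → R)),
      Function.Injective φ ∧
        Nonempty (((Fin n → R) ⧸ LinearMap.range φ) ≃ₗ[R] M) := by
  obtain ⟨x, y, hxy⟩ := hreg
  have hht : (maximalIdeal R).height = 2 := by
    rw [← WithBot.coe_inj, maximalIdeal_height_eq_ringKrullDim, hdim]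
    rfl
  have hnotmin (r : R) : maximalIdeal R ∉ (Ideal.span {r}).minimalPrimes := fun h ↦ by
    have := Ideal.height_le_one_of_isPrincipal_of_mem_minimalPrimes _ _ h
    rw [hht] at this
    exact absurd this (by decide)
  have hnotmin0 : maximalIdeal R ∉ minimalPrimes R := by
    have := hnotmin 0
    rwa [Ideal.span_singleton_eq_bot.2 rfl] at this
  have hsq : ¬ maximalIdeal R ≤ maximalIdeal R ^ 2 := fun h ↦ by
    have h0 : maximalIdeal R = ⊥ := by
      refine Submodule.eq_bot_of_le_smul_of_le_jacobson_bot (maximalIdeal R) _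
        (IsNoetherian.noetherian _) ?_ (maximalIdeal_le_jacobson _)
      rwa [smul_eq_mul, ← pow_two]
    rw [h0, Ideal.height_bot] at hht
    exact absurd hht (by decide)
  -- Prime avoidance, applied to a parameter regular on `M`.
  obtain ⟨z, hzm, hz⟩ : ∃ z ∈ maximalIdeal R, z ∉ ⋃ I ∈ insert (maximalIdeal R ^ 2)
      (minimalPrimes R ∪ associatedPrimes R M), (I : Set R) := by
    refine Set.not_subset.1 ?_
    have hfin := ((minimalPrimes.finite_of_isNoetherianRing R).union
      (associatedPrimes.finite R M)).insert (maximalIdeal R ^ 2)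
    refine (Ideal.subset_union_prime_finite hfin (f := id) (maximalIdeal R ^ 2)
      (maximalIdeal R ^ 2) ?_).not.2 ?_
    rotate_left
    · rintro ⟨I, rfl | hI | hI, hle⟩
      · exact hsq hle
      · have := hI.1.1
        exact hnotmin0 (le_antisymm (le_maximalIdeal this.ne_top) hle ▸ hI)
      · exact maximalIdeal_notMem_associatedPrimes hM
          (le_antisymm (le_maximalIdeal hI.1.ne_top) hle ▸ hI)
    · rintro I (rfl | hI | hI) h1 -
      exacts [absurd rfl h1, hI.1.1, hI.1]
  simp only [Set.mem_iUnion, not_exists, SetLike.mem_coe] at hz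
  have hzJ : z ∈ (⊥ : Ideal R).jacobson := maximalIdeal_le_jacobson _ hzm
  obtain ⟨w, hzw⟩ := exists_maximalIdeal_eq_span_pair_of_notMem_sq hxy hzm
    (hz _ (Set.mem_insert _ _))
  have hzp := isPrime_span_singleton_of_maximalIdeal_eq_span_pair hzw (hnotmin z)
  have hdom : IsDomain R := by
    obtain ⟨p, hp, hpz⟩ := Ideal.exists_minimalPrimes_le (bot_le : (⊥ : Ideal R) ≤ Ideal.span {z})
    have hlt : p < Ideal.span {z} := lt_of_le_of_ne hpz fun h ↦
      hz p (.inr (.inl hp)) (h ▸ Ideal.mem_span_singleton_self z)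
    have hp' : p.IsPrime := hp.1.1
    have := hp'.eq_bot_of_lt_span_singleton hzJ hlt
    have : (⊥ : Ideal R).IsPrime := this ▸ hp'
    exact IsDomain.of_bot_isPrime R
  have hz0 : z ≠ 0 := fun h ↦ hz _ (Set.mem_insert _ _) (h ▸ zero_mem _)
  have hzM : IsSMulRegular M z := by
    by_contra hzM
    have : z ∈ ⋃ p ∈ associatedPrimes R M, (p : Set R) := by
      rw [biUnion_associatedPrimes_eq_compl_regular]
      exact hzM
    simp only [Set.mem_iUnion] at this
    obtain ⟨p, hp, hzp⟩ := this
    exact hz p (.inr (.inr hp)) hzp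
  have : IsPrincipalIdealRing (R ⧸ Ideal.span {z}) := by
    have : IsLocalRing (R ⧸ Ideal.span {z}) :=
      .of_surjective' (Ideal.Quotient.mk _) Ideal.Quotient.mk_surjective
    have hprin : (maximalIdeal (R ⧸ Ideal.span {z})).IsPrincipal := by
      refine ⟨Ideal.Quotient.mk _ w, ?_⟩
      rw [← map_maximalIdeal_of_surjective (Ideal.Quotient.mk (Ideal.span {z}))
        Ideal.Quotient.mk_surjective, hzw, Ideal.map_span, Set.image_pair,
        Ideal.Quotient.eq_zero_iff_mem.2 (Ideal.mem_span_singleton_self z),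
        Ideal.span_insert_zero]
    exact ((tfae_of_isNoetherianRing_of_isLocalRing_of_isDomain _).out 4 0).1 hprin
  obtain ⟨n, f, hf⟩ := Module.Finite.exists_fin' R M
  have : Module.Free R (LinearMap.ker f) := Submodule.free_of_forall_mem_of_smul_mem hzJ hz0 _
    fun v hv ↦ hzM.right_eq_zero_of_smul (by simpa using hv)
  have hrank : Module.finrank R (LinearMap.ker f) = n := by
    have h1 := (LinearMap.ker f).finrank_quotient_add_finrank
    have h2 : Module.finrank R M = 0 := Module.finrank_eq_zero_iff.2 htor
    rw [(f.quotKerEquivOfSurjective hf).finrank_eq, h2, Module.finrank_fin_fun] at h1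
    simpa using h1
  let e := (Module.finBasisOfFinrankEq R _ hrank).equivFun.symm
  refine ⟨n, (LinearMap.ker f).subtype ∘ₗ e.toLinearMap,
    Subtype.val_injective.comp e.injective, ⟨?_⟩⟩
  exact Submodule.quotEquivOfEq _ _ (by simp [LinearMap.range_comp]) ≪≫ₗ
    f.quotKerEquivOfSurjective hf
end

section
/- Let A be a commutative local integral domain that is a unique factorization domain, and let f ∈ A be a squarefree element such that there exist two irreducible elements f₁, f₂ of A which both divide f and which are not associates of each other. Then the quotient ring B = A[X]/(X² − f) is an integral domain, and B is not a unique factorization domain. -/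
open Polynomial

namespace AdjoinRoot

section CommRing

variable {A : Type*} [CommRing A] {f : A}

theorem root_X_sq_sub_C_sq : root (X ^ 2 - C f) ^ 2 = of (X ^ 2 - C f) f := by
  have h := eval₂_root (X ^ 2 - C f)
  simpa [sub_eq_zero] using h

theorem exists_eq_of_add_of_mul_root [Nontrivial A] (x : AdjoinRoot (X ^ 2 - C f)) :
    ∃ a b : A, x = of _ a + of _ b * root _ := by
  have hm : (X ^ 2 - C f).Monic := monic_X_pow_sub_C f two_ne_zero
  have hd : (modByMonicHom hm x).degree ≤ 1 := by
    obtain ⟨p, rfl⟩ := mk_surjective x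
    rw [modByMonicHom_mk]
    have := degree_modByMonic_lt p hm
    rw [degree_X_pow_sub_C two_pos] at this
    exact Order.le_of_lt_succ this
  refine ⟨(modByMonicHom hm x).coeff 0, (modByMonicHom hm x).coeff 1, ?_⟩
  conv_lhs => rw [← mk_leftInverse hm x, eq_X_add_C_of_degree_le_one hd]
  simp [add_comm]

theorem of_add_of_mul_root_inj [Nontrivial A] {a b c d : A}
    (h : of (X ^ 2 - C f) a + of _ b * root _ = of _ c + of _ d * root _) : a = c ∧ b = d := by
  have hm : (X ^ 2 - C f).Monic := monic_X_pow_sub_C f two_ne_zero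
  have h0 : mk (X ^ 2 - C f) (C (b - d) * X + C (a - c)) = 0 := by
    simp only [map_add, map_mul, map_sub, mk_C, mk_X]
    linear_combination h
  have hz : C (b - d) * X + C (a - c) = 0 := by
    by_contra hne
    refine mk_ne_zero_of_degree_lt hm hne ?_ h0
    rw [degree_X_pow_sub_C two_pos]
    exact degree_linear_lt
  have h₀ := congrArg (coeff · 0) hz
  have h₁ := congrArg (coeff · 1) hz
  simp [sub_eq_zero] at h₀ h₁
  exact ⟨h₀, h₁⟩

theorem of_dvd_of_add_of_mul_root [Nontrivial A] {p a b : A} :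
    of (X ^ 2 - C f) p ∣ of _ a + of _ b * root _ ↔ p ∣ a ∧ p ∣ b := by
  constructor
  · rintro ⟨y, hy⟩
    obtain ⟨c, d, rfl⟩ := exists_eq_of_add_of_mul_root y
    have h : of (X ^ 2 - C f) a + of _ b * root _ = of _ (p * c) + of _ (p * d) * root _ := by
      rw [hy, map_mul, map_mul]; ring
    obtain ⟨rfl, rfl⟩ := of_add_of_mul_root_inj h
    exact ⟨dvd_mul_right _ _, dvd_mul_right _ _⟩
  · rintro ⟨ha, hb⟩
    exact dvd_add (_root_.map_dvd _ ha) ((_root_.map_dvd _ hb).mul_right _)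

/-- A prime `p` not dividing `g` stays relatively prime to `g` in `A[√f]`. -/
theorem isRelPrime_of [IsDomain A] [IsDomain (AdjoinRoot (X ^ 2 - C f))] {p g : A}
    (hp : Prime p) (hpg : ¬ p ∣ g) :
    IsRelPrime (of (X ^ 2 - C f) p) (of (X ^ 2 - C f) g) := by
  rintro d ⟨e, he⟩ ⟨h, hh⟩
  have hp0 : of (X ^ 2 - C f) p ≠ 0 := by
    intro h0
    exact hp.ne_zero (of_add_of_mul_root_inj (f := f) (b := 0) (d := 0) (by simpa using h0)).1
  have hpe : of (X ^ 2 - C f) p ∣ e := by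
    obtain ⟨a, b, rfl⟩ := exists_eq_of_add_of_mul_root e
    have hdvd : of (X ^ 2 - C f) p ∣ of _ (g * a) + of _ (g * b) * root _ := by
      refine ⟨h, ?_⟩
      rw [he, map_mul, map_mul, hh]; ring
    rw [of_dvd_of_add_of_mul_root] at hdvd ⊢
    exact ⟨(hp.dvd_or_dvd hdvd.1).resolve_left hpg, (hp.dvd_or_dvd hdvd.2).resolve_left hpg⟩
  obtain ⟨c, rfl⟩ := hpe
  exact IsUnit.of_mul_eq_one c (mul_left_cancel₀ hp0 (by linear_combination -he))

theorem isUnit_of_isUnit_of_add_of_mul_root [IsLocalRing A] (hf : ¬ IsUnit f) {a b : A}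
    (h : IsUnit (of (X ^ 2 - C f) a + of _ b * root _)) : IsUnit a := by
  obtain ⟨y, hy⟩ := h.exists_right_inv
  obtain ⟨c, d, rfl⟩ := exists_eq_of_add_of_mul_root y
  have h1 : of (X ^ 2 - C f) (a * c + f * (b * d)) + of _ (a * d + b * c) * root _
      = of _ 1 + of _ 0 * root _ := by
    simp only [map_add, map_mul, map_one, map_zero, ← root_X_sq_sub_C_sq]
    linear_combination hy
  rcases IsLocalRing.isUnit_or_isUnit_of_add_one (of_add_of_mul_root_inj h1).1 with hu | hu
  · exact isUnit_of_mul_isUnit_left hu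
  · exact absurd (isUnit_of_mul_isUnit_left hu) hf

/-- In `A[√(pg)]` with `A` local, a prime `p` of `A` is not a square up to units. -/
theorem not_associated_sq_of [IsLocalRing A] [IsDomain A] {p g : A} (hp : Prime p)
    (hg : ¬ IsUnit g) (d : AdjoinRoot (X ^ 2 - C (p * g))) :
    ¬ Associated (of (X ^ 2 - C (p * g)) p) (d ^ 2) := by
  rintro ⟨u, hu⟩
  obtain ⟨a, b, rfl⟩ := exists_eq_of_add_of_mul_root d
  obtain ⟨w, v, hw⟩ := exists_eq_of_add_of_mul_root (u : AdjoinRoot (X ^ 2 - C (p * g)))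
  have hwu : IsUnit w := isUnit_of_isUnit_of_add_of_mul_root
    (fun h => hp.not_isUnit (isUnit_of_mul_isUnit_left h)) (hw ▸ u.isUnit)
  have h1 : of (X ^ 2 - C (p * g)) (p * w) + of _ (p * v) * root _
      = of _ (a ^ 2 + p * g * b ^ 2) + of _ (2 * a * b) * root _ := by
    have hsq := root_X_sq_sub_C_sq (f := p * g)
    rw [hw] at hu
    simp only [map_add, map_mul, map_pow, map_ofNat] at hsq ⊢
    linear_combination hu + (of (X ^ 2 - C (p * g)) b) ^ 2 * hsq
  have h2 := (of_add_of_mul_root_inj h1).1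
  obtain ⟨c, rfl⟩ : p ∣ a := hp.dvd_of_dvd_pow (n := 2)
    ⟨w - g * b ^ 2, by linear_combination -h2⟩
  have h3 : w = p * c ^ 2 + g * b ^ 2 :=
    mul_left_cancel₀ hp.ne_zero (by linear_combination h2)
  rcases IsLocalRing.isUnit_or_isUnit_of_isUnit_add (h3 ▸ hwu) with h | h
  · exact hp.not_isUnit (isUnit_of_mul_isUnit_left h)
  · exact hg (isUnit_of_mul_isUnit_left h)

end CommRing

end AdjoinRoot

theorem Polynomial.irreducible_X_sq_sub_C {A : Type*} [CommRing A] [IsDomain A] {f : A}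
    (hf : ¬ IsSquare f) : Irreducible (X ^ 2 - C f) := by
  have hm : (X ^ 2 - C f).Monic := monic_X_pow_sub_C f two_ne_zero
  have hd : (X ^ 2 - C f).natDegree = 2 := natDegree_X_pow_sub_C
  rw [hm.irreducible_iff_roots_eq_zero_of_degree_le_three hd.ge (by lia),
    Multiset.eq_zero_iff_forall_notMem]
  intro a ha
  have h := (mem_roots'.1 ha).2
  simp only [IsRoot.def, eval_sub, eval_pow, eval_X, eval_C, sub_eq_zero] at h
  exact hf ⟨a, by rw [← h, sq]⟩

open AdjoinRoot in
/-- Let `A` be a commutative local integral domain that is a UFD, and let `f ∈ A` be a squarefree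
element divisible by two non-associate irreducible elements `f₁`, `f₂`.  Then
`B = A[X]/(X² − f)` is an integral domain which is not a UFD. -/
theorem quotient_squarefree_quadratic_not_UFD
    (A : Type) [CommRing A] [IsLocalRing A] [IsDomain A] [UniqueFactorizationMonoid A]
    (f : A) (hf : Squarefree f)
    (f₁ f₂ : A) (h₁ : Irreducible f₁) (h₂ : Irreducible f₂)
    (h₁f : f₁ ∣ f) (h₂f : f₂ ∣ f) (h₁₂ : ¬ Associated f₁ f₂) :
    ∃ _ : IsDomain (Polynomial A ⧸ Ideal.span {Polynomial.X ^ 2 - Polynomial.C f}),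
      ¬ UniqueFactorizationMonoid
        (Polynomial A ⧸ Ideal.span {Polynomial.X ^ 2 - Polynomial.C f}) := by
  have hsq : ¬ IsSquare f := by
    rintro ⟨a, rfl⟩
    have ha := hf a dvd_rfl
    exact h₁.not_isUnit (isUnit_of_dvd_unit h₁f (ha.mul ha))
  have hdom : IsDomain (AdjoinRoot (X ^ 2 - C f)) :=
    isDomain_of_prime (irreducible_X_sq_sub_C hsq).prime
  refine ⟨hdom, fun hufd => ?_⟩
  have hufd : UniqueFactorizationMonoid (AdjoinRoot (X ^ 2 - C f)) := hufd
  obtain ⟨g, rfl⟩ := h₁f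
  have hg : ¬ IsUnit g := fun h =>
    h₁₂ (h₂.associated_of_dvd h₁ (h.dvd_mul_right.1 h₂f)).symm
  have h₁g : ¬ f₁ ∣ g := fun h => h₁.not_isUnit (hf f₁ (mul_dvd_mul_left f₁ h))
  let _ := UniqueFactorizationMonoid.toGCDMonoid (AdjoinRoot (X ^ 2 - C (f₁ * g)))
  obtain ⟨d, hd⟩ := exists_associated_pow_of_mul_eq_pow
    ((gcd_isUnit_iff_isRelPrime).2 (isRelPrime_of (f := f₁ * g) h₁.prime h₁g))
    ((map_mul _ _ _).symm.trans (root_X_sq_sub_C_sq (f := f₁ * g)).symm)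
  exact not_associated_sq_of h₁.prime hg d hd.symm
end

section
/- Let A be a unique factorization domain in which 2 is a unit, and let f ∈ A be a squarefree element that is not a unit. Then B = A[X]/(X² − f) is an integral domain that is integrally closed in its field of fractions. -/
open Polynomial

/-- An element of an integrally closed domain divides another one as soon as the quotient of the
two is integral in some field extension. -/
theorem IsIntegrallyClosed.dvd_of_isIntegral_of_algebraMap_mul_eq {A L : Type*} [CommRing A]
    [IsDomain A] [IsIntegrallyClosed A] [Field L] [Algebra A L] [FaithfulSMul A L] {a d : A}
    (hd : d ≠ 0) {y : L} (hy : IsIntegral A y) (h : algebraMap A L d * y = algebraMap A L a) :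
    d ∣ a := by
  have hinj : Function.Injective (Algebra.ofId A L) := FaithfulSMul.algebraMap_injective A L
  let φ : FractionRing A →ₐ[A] L := IsFractionRing.liftAlgHom hinj
  have hdK : algebraMap A (FractionRing A) d ≠ 0 := by simpa using hd
  have hdL : algebraMap A L d ≠ 0 := by simpa using hd
  have hφ : φ (algebraMap A (FractionRing A) a / algebraMap A (FractionRing A) d) = y := by
    rw [map_div₀, φ.commutes, φ.commutes, ← h, mul_div_cancel_left₀ _ hdL]
  rw [← hφ, isIntegral_algHom_iff φ φ.injective, IsIntegrallyClosed.isIntegral_iff] at hy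
  obtain ⟨c, hc⟩ := hy
  refine ⟨c, FaithfulSMul.algebraMap_injective A (FractionRing A) ?_⟩
  rw [map_mul, hc, mul_div_cancel₀ _ hdK]

theorem Squarefree.dvd_of_mul_self_dvd_mul_mul_self {A : Type*} [CommRing A] [IsDomain A]
    [UniqueFactorizationMonoid A] {f d v : A} (hf : Squarefree f) (hd : d ≠ 0)
    (h : d * d ∣ f * (v * v)) : d ∣ v := by
  obtain ⟨a, b, c, hab, rfl, rfl⟩ := UniqueFactorizationMonoid.exists_reduced_factors d hd v
  have hc : c * c ≠ 0 := mul_self_ne_zero.mpr (left_ne_zero_of_mul hd)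
  rw [mul_mul_mul_comm, mul_mul_mul_comm c b, mul_left_comm f, mul_dvd_mul_iff_left hc] at h
  have ha : IsUnit a := hf a ((IsRelPrime.mul_left (hab.mul_right hab)
    (hab.mul_right hab)).dvd_of_dvd_mul_right h)
  exact mul_dvd_mul_left c ha.dvd

/-- Let `B` be a domain generated over a UFD `A` in which `2` is a unit by a square root `θ` of a
squarefree element, with an injective `A`-linear endomorphism sending `θ` to `-θ`. Then every
element of the fraction field of `B` that is integral over `A` lies in `B`. -/
theorem exists_algebraMap_eq_of_isIntegral_of_sq_eq_squarefree {A B L : Type*} [CommRing A]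
    [IsDomain A] [UniqueFactorizationMonoid A] [CommRing B] [IsDomain B] [Algebra A B]
    [FaithfulSMul A B] [Field L] [Algebra B L] [IsFractionRing B L] [Algebra A L]
    [IsScalarTower A B L] (h2 : IsUnit (2 : A)) {f : A} (hf : Squarefree f) {θ : B}
    (hθ : θ ^ 2 = algebraMap A B f)
    (hgen : ∀ b : B, ∃ u v : A, b = algebraMap A B u + algebraMap A B v * θ)
    (σ : B →ₐ[A] B) (hσ : Function.Injective σ) (hσθ : σ θ = -θ) {x : L} (hx : IsIntegral A x) :
    ∃ b : B, algebraMap B L b = x := by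
  have hBL : Function.Injective (algebraMap B L) := FaithfulSMul.algebraMap_injective B L
  have hAL (a : A) : algebraMap A L a = algebraMap B L (algebraMap A B a) :=
    IsScalarTower.algebraMap_apply A B L a
  have : FaithfulSMul A L := .trans A B L
  have hg : Function.Injective ((IsScalarTower.toAlgHom A B L).comp σ) := hBL.comp hσ
  let τ : L →ₐ[A] L := IsFractionRing.liftAlgHom hg
  have hτ (b : B) : τ (algebraMap B L b) = algebraMap B L (σ b) :=
    IsFractionRing.lift_algebraMap hg b
  have hτθ : τ (algebraMap B L θ) = -algebraMap B L θ := by rw [hτ, hσθ, map_neg]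
  have hθL : algebraMap B L θ ^ 2 = algebraMap A L f := by rw [← map_pow, hθ, hAL]
  obtain ⟨u, v, d, hd, hxd⟩ : ∃ u v d : A, d ≠ 0 ∧
      algebraMap A L d * x = algebraMap A L u + algebraMap A L v * algebraMap B L θ := by
    obtain ⟨b, c, hc, rfl⟩ := IsFractionRing.div_surjective (A := B) x
    have hc0 : c ≠ 0 := nonZeroDivisors.ne_zero hc
    obtain ⟨r, s, hrs⟩ := hgen c
    obtain ⟨u, v, huv⟩ := hgen (b * σ c)
    have hnorm : algebraMap A B (r ^ 2 - f * s ^ 2) = c * σ c := by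
      rw [hrs]
      simp only [map_add, map_mul, map_sub, map_pow, AlgHom.commutes, hσθ, ← hθ]
      ring
    refine ⟨u, v, r ^ 2 - f * s ^ 2, fun h0 ↦ ?_, ?_⟩
    · rw [h0, map_zero, eq_comm, mul_eq_zero, map_eq_zero_iff σ hσ] at hnorm
      tauto
    · have hcL : algebraMap B L c ≠ 0 := by simpa using hc0
      rw [hAL, hnorm, hAL u, hAL v, ← map_mul (algebraMap B L) _ θ, ← map_add, ← huv, map_mul,
        map_mul]
      field_simp
  have hτx : algebraMap A L d * τ x =
      algebraMap A L u - algebraMap A L v * algebraMap B L θ := by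
    have := congrArg τ hxd
    simp only [map_mul, map_add, AlgHom.commutes, hτθ] at this
    rw [this]
    ring
  have hτint : IsIntegral A (τ x) := hx.map τ
  obtain ⟨a, rfl⟩ : d ∣ u := by
    rw [← h2.dvd_mul_left]
    refine IsIntegrallyClosed.dvd_of_isIntegral_of_algebraMap_mul_eq hd (hx.add hτint) ?_
    rw [mul_add, hxd, hτx, map_mul, map_ofNat]
    ring
  obtain ⟨b, rfl⟩ : d ∣ v := by
    refine hf.dvd_of_mul_self_dvd_mul_mul_self hd ?_
    rw [← (h2.mul h2).dvd_mul_left]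
    refine IsIntegrallyClosed.dvd_of_isIntegral_of_algebraMap_mul_eq (mul_self_ne_zero.mpr hd)
      ((hx.sub hτint).pow 2) ?_
    have hsub : algebraMap A L d * (x - τ x) = 2 * algebraMap A L v * algebraMap B L θ := by
      rw [mul_sub, hxd, hτx]
      ring
    simp only [map_mul, map_ofNat, ← hθL]
    linear_combination (algebraMap A L d * (x - τ x) +
      2 * algebraMap A L v * algebraMap B L θ) * hsub
  have hdL : algebraMap A L d ≠ 0 := by simpa using hd
  refine ⟨algebraMap A B a + algebraMap A B b * θ, mul_left_cancel₀ hdL ?_⟩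
  rw [hxd]
  simp only [map_add, map_mul, ← hAL]
  ring

/-- A domain that is generated over a UFD `A` in which `2` is a unit by a square root `θ` of a
squarefree element, and that has an injective `A`-linear endomorphism sending `θ` to `-θ`, is
integrally closed. -/
theorem isIntegrallyClosed_of_sq_eq_squarefree {A B : Type*} [CommRing A] [IsDomain A]
    [UniqueFactorizationMonoid A] [CommRing B] [IsDomain B] [Algebra A B] [FaithfulSMul A B]
    (h2 : IsUnit (2 : A)) {f : A} (hf : Squarefree f) {θ : B} (hθ : θ ^ 2 = algebraMap A B f)
    (hgen : ∀ b : B, ∃ u v : A, b = algebraMap A B u + algebraMap A B v * θ)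
    (σ : B →ₐ[A] B) (hσ : Function.Injective σ) (hσθ : σ θ = -θ) : IsIntegrallyClosed B := by
  have hint : Algebra.IsIntegral A B := ⟨fun b ↦ by
    obtain ⟨u, v, rfl⟩ := hgen b
    exact isIntegral_algebraMap.add (isIntegral_algebraMap.mul
      (IsIntegral.of_pow two_pos (hθ ▸ isIntegral_algebraMap)))⟩
  exact (isIntegrallyClosed_iff (FractionRing B)).mpr fun {x} hx ↦
    exists_algebraMap_eq_of_isIntegral_of_sq_eq_squarefree h2 hf hθ hgen σ hσ hσθ
      (isIntegral_trans x hx)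

/-- Let `A` be a UFD in which `2` is a unit and let `f ∈ A` be a squarefree non-unit.  Then
`B = A[X]/(X² − f)` is an integral domain which is integrally closed in its field of
fractions. -/
theorem quotient_squarefree_quadratic_integrallyClosed
    (A : Type) [CommRing A] [IsDomain A] [UniqueFactorizationMonoid A]
    (h2 : IsUnit (2 : A)) (f : A) (hf : Squarefree f) (hfu : ¬ IsUnit f) :
    IsDomain (Polynomial A ⧸ Ideal.span {Polynomial.X ^ 2 - Polynomial.C f}) ∧
      IsIntegrallyClosed (Polynomial A ⧸ Ideal.span {Polynomial.X ^ 2 - Polynomial.C f}) := by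
  have hsq : ¬ IsSquare f := by
    rintro ⟨a, rfl⟩
    have ha := hf a dvd_rfl
    exact hfu (ha.mul ha)
  have hprime : Prime (X ^ 2 - C f) := (irreducible_X_sq_sub_C hsq).prime
  have hmonic : (X ^ 2 - C f).Monic := monic_X_pow_sub_C f two_ne_zero
  have hdeg : (X ^ 2 - C f).degree = 2 := degree_X_pow_sub_C two_pos f
  change IsDomain (AdjoinRoot (X ^ 2 - C f)) ∧ IsIntegrallyClosed (AdjoinRoot (X ^ 2 - C f))
  have hdom := AdjoinRoot.isDomain_of_prime hprime
  have : FaithfulSMul A (AdjoinRoot (X ^ 2 - C f)) :=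
    (faithfulSMul_iff_algebraMap_injective _ _).mpr
      (AdjoinRoot.of.injective_of_degree_ne_zero (by rw [hdeg]; norm_num))
  have hθ : AdjoinRoot.root (X ^ 2 - C f) ^ 2 = algebraMap A _ f := by
    have := AdjoinRoot.eval₂_root (X ^ 2 - C f)
    rwa [eval₂_sub, eval₂_X_pow, eval₂_C, sub_eq_zero] at this
  let σ : AdjoinRoot (X ^ 2 - C f) →ₐ[A] AdjoinRoot (X ^ 2 - C f) :=
    AdjoinRoot.liftAlgHom _ (Algebra.ofId _ _) (-AdjoinRoot.root _) (by
      rw [eval₂_sub, eval₂_X_pow, eval₂_C, neg_sq, hθ]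
      exact sub_self _)
  have hσθ : σ (AdjoinRoot.root _) = -AdjoinRoot.root _ := AdjoinRoot.liftAlgHom_root ..
  have hσσ : σ.comp σ = AlgHom.id A _ := AdjoinRoot.algHom_ext (by simp [hσθ])
  have hσ : Function.Injective σ :=
    Function.LeftInverse.injective (g := σ) fun b ↦ DFunLike.congr_fun hσσ b
  refine ⟨hdom, isIntegrallyClosed_of_sq_eq_squarefree h2 hf hθ (fun b ↦ ?_) σ hσ hσθ⟩
  obtain ⟨p, rfl⟩ := AdjoinRoot.mk_surjective b
  obtain ⟨v, u, huv⟩ := exists_eq_X_add_C_of_natDegree_le_one (p := p %ₘ (X ^ 2 - C f)) (by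
    have := natDegree_modByMonic_lt p hmonic (fun h ↦ hprime.not_isUnit (h ▸ isUnit_one))
    rw [natDegree_X_pow_sub_C] at this
    lia)
  refine ⟨u, v, ?_⟩
  rw [← AdjoinRoot.mk_leftInverse hmonic (AdjoinRoot.mk _ p), AdjoinRoot.modByMonicHom_mk, huv]
  simp [add_comm]
end
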